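/- arXiv:2509.09519 — 2 statements merged into one kernel-verified Lean document; each statement's English description precedes it below -/
import Mathlib

section
/- Let γ ∈ (−1, ∞) and ν ∈ (−2, ∞). Then there exist constants 0 < c ≤ C < ∞, depending only on γ, ν and κ, such that for all x ∈ 𝒟 and all r > 0: c · r² (ρ_∘(x)+r)^{ν−γ} (ρ_𝒟(x)+r)^{γ} ≤ w_{γ,ν}(B(x, r)) ≤ C · r² (ρ_∘(x)+r)^{ν−γ} (ρ_𝒟(x)+r)^{γ}. -/
open MeasureTheory Set Real
open scoped ENNReal

noncomputable section

abbrev E2 := EuclideanSpace ℝ (Fin 2)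

/-- The planar angular domain with opening angle `κ`. -/
def Dset (κ : ℝ) : Set E2 :=
  {x | ∃ r φ : ℝ, 0 < r ∧ 0 < φ ∧ φ < κ ∧ x 0 = r * Real.cos φ ∧ x 1 = r * Real.sin φ}

/-- `B(x, r)`: the part of the Euclidean ball of radius `r` around `x` lying in `𝒟`. -/
def ballD (κ : ℝ) (x : E2) (r : ℝ) : Set E2 :=
  {y | y ∈ Dset κ ∧ dist y x < r}

/-- Geodesic (arc-length) distance between unit vectors of `S¹ ⊆ ℝ²`. -/
def dS1 (u v : E2) : ℝ := Real.arccos (inner ℝ u v)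

/-- The "windshield wiper" set `S(x, r)`; for `x = 0` the angular condition is vacuous
(convention `a/0 = ∞`). -/
def Sset (κ : ℝ) (x : E2) (r : ℝ) : Set E2 :=
  {y | y ∈ Dset κ ∧ |‖y‖ - ‖x‖| < r ∧ (x ≠ 0 → dS1 (‖x‖⁻¹ • x) (‖y‖⁻¹ • y) < r / ‖x‖)}

/-- Distance from `x` to the boundary of `𝒟`. -/
def rhoD (κ : ℝ) (x : E2) : ℝ := Metric.infDist x (frontier (Dset κ))

/-- The mixed power weight `w_{γ,ν}(x) = ρ_∘(x)^{ν-γ} ρ_𝒟(x)^γ`. -/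
def wgt (κ γ ν : ℝ) (x : E2) : ℝ := ‖x‖ ^ (ν - γ) * rhoD κ x ^ γ

/-- `w_{γ,ν}(E) = ∫_E w_{γ,ν} dx`, valued in `[0,∞]`. -/
def wMeas (κ γ ν : ℝ) (E : Set E2) : ℝ≥0∞ :=
  ∫⁻ x in E, ENNReal.ofReal (wgt κ γ ν x)

/-- The inner unit normal of `Dset κ` along the ray of angle `0`. -/
def normalZero : E2 := !₂[0, 1]

/-- The inner unit normal of `Dset κ` along the ray of angle `κ`. -/
def normalAngle (κ : ℝ) : E2 := !₂[Real.sin κ, -Real.cos κ]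

/-- The unit vector spanning the bisector of `Dset κ`. -/
def bisector (κ : ℝ) : E2 := !₂[Real.cos (κ / 2), Real.sin (κ / 2)]

lemma inner_normalZero (y : E2) : inner ℝ normalZero y = y 1 := by
  simp [normalZero, PiLp.inner_apply, Fin.sum_univ_two]

lemma inner_normalAngle (κ : ℝ) (y : E2) :
    inner ℝ (normalAngle κ) y = y 0 * Real.sin κ - y 1 * Real.cos κ := by
  simp [normalAngle, PiLp.inner_apply, Fin.sum_univ_two]; ring

lemma norm_normalZero : ‖normalZero‖ = 1 := by
  simp [normalZero, EuclideanSpace.norm_eq, Fin.sum_univ_two]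

lemma norm_normalAngle (κ : ℝ) : ‖normalAngle κ‖ = 1 := by
  simp [normalAngle, EuclideanSpace.norm_eq, Fin.sum_univ_two]

lemma norm_bisector (κ : ℝ) : ‖bisector κ‖ = 1 := by
  simp [bisector, EuclideanSpace.norm_eq, Fin.sum_univ_two]

lemma inner_normalZero_bisector (κ : ℝ) :
    inner ℝ normalZero (bisector κ) = Real.sin (κ / 2) := by
  simp [inner_normalZero, bisector]

lemma inner_normalAngle_bisector (κ : ℝ) :
    inner ℝ (normalAngle κ) (bisector κ) = Real.sin (κ / 2) := by
  have h : Real.sin (κ - κ / 2) = Real.sin (κ / 2) := by congr 1; ring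
  rw [Real.sin_sub] at h
  simp only [inner_normalAngle, bisector]
  simp
  linarith

lemma exists_polar_of_pos {a b : ℝ} (hb : 0 < b) :
    ∃ r φ : ℝ, 0 < r ∧ 0 < φ ∧ φ < π ∧ a = r * Real.cos φ ∧ b = r * Real.sin φ := by
  have hz : (⟨a, b⟩ : ℂ) ≠ 0 := fun h => hb.ne' (congrArg Complex.im h)
  refine ⟨‖(⟨a, b⟩ : ℂ)‖, Complex.arg ⟨a, b⟩, norm_pos_iff.2 hz, ?_, ?_, ?_, ?_⟩
  · refine lt_of_le_of_ne (Complex.arg_nonneg_iff.2 hb.le) fun h => ?_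
    exact hb.ne' (Complex.arg_eq_zero_iff.1 h.symm).2
  · refine lt_of_le_of_ne (Complex.arg_le_pi _) fun h => ?_
    exact hb.ne' (Complex.arg_eq_pi_iff.1 h).2
  · exact (Complex.norm_mul_cos_arg ⟨a, b⟩).symm
  · exact (Complex.norm_mul_sin_arg ⟨a, b⟩).symm

lemma Dset_eq_inter {κ : ℝ} (hκ : 0 < κ) (hκ' : κ ≤ π) :
    Dset κ = {y | 0 < inner ℝ normalZero y} ∩ {y | 0 < inner ℝ (normalAngle κ) y} := by
  ext y
  simp only [Dset, mem_inter_iff, mem_ofPred_eq, inner_normalZero,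
    inner_normalAngle]
  constructor
  · rintro ⟨r, φ, hr, h0, h1, e0, e1⟩
    rw [e0, e1]
    have h2 : 0 < Real.sin (κ - φ) := Real.sin_pos_of_pos_of_lt_pi (by linarith) (by linarith)
    rw [Real.sin_sub] at h2
    refine ⟨mul_pos hr (Real.sin_pos_of_pos_of_lt_pi h0 (by linarith)), ?_⟩
    nlinarith [mul_pos hr h2]
  · rintro ⟨h1, h2⟩
    obtain ⟨r, φ, hr, h0, hπ, e0, e1⟩ := exists_polar_of_pos (a := y 0) h1
    refine ⟨r, φ, hr, h0, ?_, e0, e1⟩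
    by_contra! h
    have h3 : Real.sin (φ - κ) < 0 := by
      rw [Real.sin_sub]
      rw [e0, e1] at h2
      by_contra! h4
      nlinarith [mul_nonneg hr.le h4]
    exact absurd (Real.sin_nonneg_of_nonneg_of_le_pi (by linarith) (by linarith)) (not_le.2 h3)

lemma Dset_eq_union {κ : ℝ} (hκ : π ≤ κ) (hκ' : κ < 2 * π) :
    Dset κ = {y | 0 < inner ℝ normalZero y} ∪ {y | 0 < inner ℝ (normalAngle κ) y} := by
  have hpi := Real.pi_pos
  ext y
  simp only [Dset, mem_union, mem_ofPred_eq, inner_normalZero, inner_normalAngle]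
  constructor
  · rintro ⟨r, φ, hr, h0, h1, e0, e1⟩
    rw [e0, e1]
    rcases lt_or_ge φ π with h | h
    · exact Or.inl (mul_pos hr (Real.sin_pos_of_pos_of_lt_pi h0 h))
    · have h2 : 0 < Real.sin (κ - φ) :=
        Real.sin_pos_of_pos_of_lt_pi (by linarith) (by linarith)
      rw [Real.sin_sub] at h2
      right
      nlinarith [mul_pos hr h2]
  · rintro (h1 | h2)
    · obtain ⟨r, φ, hr, h0, hπ, e0, e1⟩ := exists_polar_of_pos (a := y 0) h1
      exact ⟨r, φ, hr, h0, by linarith, e0, e1⟩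
    · obtain ⟨r, ψ, hr, h0, hπ, e0, e1⟩ :=
        exists_polar_of_pos (a := y 0 * Real.cos κ + y 1 * Real.sin κ) h2
      refine ⟨r, κ - ψ, hr, by linarith, by linarith, ?_, ?_⟩
      · rw [Real.cos_sub]
        linear_combination Real.cos κ * e0 + Real.sin κ * e1
          - y 0 * Real.sin_sq_add_cos_sq κ
      · rw [Real.sin_sub]
        linear_combination Real.sin κ * e0 - Real.cos κ * e1
          - y 1 * Real.sin_sq_add_cos_sq κ

lemma isOpen_halfPlane (n : E2) : IsOpen {y : E2 | 0 < inner ℝ n y} :=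
  isOpen_lt continuous_const (by fun_prop)

lemma frontier_halfPlane_subset (n : E2) :
    frontier {y : E2 | 0 < inner ℝ n y} ⊆ {y | inner ℝ n y = 0} := fun _ hy =>
  (frontier_lt_subset_eq continuous_const (by fun_prop) hy).symm

lemma isOpen_Dset {κ : ℝ} (hκ : 0 < κ) (hκ' : κ < 2 * π) : IsOpen (Dset κ) := by
  rcases le_total κ π with h | h
  · rw [Dset_eq_inter hκ h]
    exact (isOpen_halfPlane _).inter (isOpen_halfPlane _)
  · rw [Dset_eq_union h hκ']
    exact (isOpen_halfPlane _).union (isOpen_halfPlane _)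

lemma frontier_Dset_subset {κ : ℝ} (hκ : 0 < κ) (hκ' : κ < 2 * π) {y : E2}
    (hy : y ∈ frontier (Dset κ)) :
    inner ℝ normalZero y = 0 ∨ inner ℝ (normalAngle κ) y = 0 := by
  rcases le_total κ π with h | h
  · rw [Dset_eq_inter hκ h] at hy
    exact (frontier_inter_subset _ _ hy).imp (fun h => frontier_halfPlane_subset _ h.1)
      (fun h => frontier_halfPlane_subset _ h.2)
  · rw [Dset_eq_union h hκ'] at hy
    exact (frontier_union_subset _ _ hy).imp (fun h => frontier_halfPlane_subset _ h.1)
      (fun h => frontier_halfPlane_subset _ h.2)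

lemma Dset_of_inner_le {κ : ℝ} (hκ : 0 < κ) (hκ' : κ < 2 * π) {x y : E2} (hx : x ∈ Dset κ)
    (h1 : inner ℝ normalZero x ≤ inner ℝ normalZero y)
    (h2 : inner ℝ (normalAngle κ) x ≤ inner ℝ (normalAngle κ) y) : y ∈ Dset κ := by
  rcases le_total κ π with h | h
  · rw [Dset_eq_inter hκ h] at hx ⊢
    exact ⟨lt_of_lt_of_le hx.1 h1, lt_of_lt_of_le hx.2 h2⟩
  · rw [Dset_eq_union h hκ'] at hx ⊢
    exact hx.imp (fun h => lt_of_lt_of_le h h1) (fun h => lt_of_lt_of_le h h2)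

lemma zero_mem_frontier_Dset {κ : ℝ} (hκ : 0 < κ) (hκ' : κ < 2 * π) :
    (0 : E2) ∈ frontier (Dset κ) := by
  rw [(isOpen_Dset hκ hκ').frontier_eq]
  constructor
  · have hlim : Filter.Tendsto (fun t : ℝ => t • bisector κ) (nhdsWithin 0 (Ioi 0))
        (nhds (0 : E2)) := by
      have : Filter.Tendsto (fun t : ℝ => t • bisector κ) (nhds 0)
          (nhds ((0 : ℝ) • bisector κ)) := by
        apply Continuous.tendsto; fun_prop
      rw [zero_smul] at this
      exact this.mono_left nhdsWithin_le_nhds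
    refine mem_closure_of_tendsto hlim ?_
    filter_upwards [self_mem_nhdsWithin] with t ht
    exact ⟨t, κ / 2, ht, by linarith, by linarith, by simp [bisector], by simp [bisector]⟩
  · rintro ⟨r, φ, hr, -, -, e0, e1⟩
    simp only [PiLp.zero_apply] at e0 e1
    have := Real.sin_sq_add_cos_sq φ
    rcases mul_eq_zero.1 e0.symm with h | h
    · exact hr.ne' h
    rcases mul_eq_zero.1 e1.symm with h' | h'
    · exact hr.ne' h'
    rw [h, h'] at this
    norm_num at this

lemma rhoD_nonneg (κ : ℝ) (x : E2) : 0 ≤ rhoD κ x := Metric.infDist_nonneg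

lemma rhoD_zero {κ : ℝ} (hκ : 0 < κ) (hκ' : κ < 2 * π) : rhoD κ 0 = 0 :=
  Metric.infDist_zero_of_mem (zero_mem_frontier_Dset hκ hκ')

lemma rhoD_le_add_dist (κ : ℝ) (x y : E2) : rhoD κ x ≤ rhoD κ y + dist x y :=
  Metric.infDist_le_infDist_add_dist

lemma rhoD_le_norm {κ : ℝ} (hκ : 0 < κ) (hκ' : κ < 2 * π) (x : E2) : rhoD κ x ≤ ‖x‖ := by
  simpa [rhoD_zero hκ hκ'] using rhoD_le_add_dist κ x 0

/-- The distance to the boundary dominates the distance to one of the two bounding lines. -/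
lemma min_abs_inner_le_rhoD {κ : ℝ} (hκ : 0 < κ) (hκ' : κ < 2 * π) (y : E2) :
    min |inner ℝ normalZero y| |inner ℝ (normalAngle κ) y| ≤ rhoD κ y := by
  refine (Metric.le_infDist ⟨0, zero_mem_frontier_Dset hκ hκ'⟩).2 fun z hz => ?_
  have key : ∀ n : E2, ‖n‖ = 1 → inner ℝ n z = 0 → |inner ℝ n y| ≤ dist y z := fun n hn h => by
    have := abs_real_inner_le_norm n (y - z)
    rwa [inner_sub_right, h, sub_zero, hn, one_mul, ← dist_eq_norm] at this
  rcases frontier_Dset_subset hκ hκ' hz with h | h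
  · exact (min_le_left _ _).trans (key _ norm_normalZero h)
  · exact (min_le_right _ _).trans (key _ (norm_normalAngle κ) h)

lemma le_rhoD_of_ball_subset {κ : ℝ} (hκ : 0 < κ) (hκ' : κ < 2 * π) {z : E2} {s : ℝ}
    (h : Metric.ball z s ⊆ Dset κ) : s ≤ rhoD κ z := by
  refine (Metric.le_infDist ⟨0, zero_mem_frontier_Dset hκ hκ'⟩).2 fun w hw => ?_
  by_contra! hlt
  rw [(isOpen_Dset hκ hκ').frontier_eq] at hw
  exact hw.2 (h (by rwa [Metric.mem_ball, dist_comm]))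

/-- Moving along the bisector produces a ball inside the angular domain. -/
lemma ball_add_smul_bisector_subset {κ : ℝ} (hκ : 0 < κ) (hκ' : κ < 2 * π) {x : E2}
    (hx : x ∈ Dset κ) (t : ℝ) :
    Metric.ball (x + t • bisector κ) (t * Real.sin (κ / 2)) ⊆ Dset κ := by
  intro y hy
  rw [Metric.mem_ball, dist_eq_norm] at hy
  have key : ∀ n : E2, ‖n‖ = 1 → inner ℝ n (bisector κ) = Real.sin (κ / 2) →
      inner ℝ n x ≤ inner ℝ n y := fun n hn hb => by
    have h := abs_real_inner_le_norm n (y - (x + t • bisector κ))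
    rw [hn, one_mul, inner_sub_right, inner_add_right, inner_smul_right, hb] at h
    linarith [(abs_le.1 h).1]
  exact Dset_of_inner_le hκ hκ' hx (key _ norm_normalZero (inner_normalZero_bisector κ))
    (key _ (norm_normalAngle κ) (inner_normalAngle_bisector κ))

lemma rpow_le_mul_rpow {K s t : ℝ} (hs : 0 < s) (ht : 0 < t) (h1 : s ≤ K * t)
    (h2 : t ≤ K * s) (a : ℝ) : s ^ a ≤ K ^ |a| * t ^ a := by
  have hK : 0 < K := pos_of_mul_pos_left (hs.trans_le h1) ht.le
  rcases le_total 0 a with ha | ha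
  · rw [abs_of_nonneg ha, ← Real.mul_rpow hK.le ht.le]
    exact Real.rpow_le_rpow hs.le h1 ha
  · rw [abs_of_nonpos ha, Real.rpow_neg hK.le, ← Real.inv_rpow hK.le,
      ← Real.mul_rpow (inv_nonneg.2 hK.le) ht.le]
    refine Real.rpow_le_rpow_of_nonpos (by positivity) ?_ ha
    rwa [inv_mul_le_iff₀ hK]

lemma ofReal_rpow_le_enorm_rpow (t : ℝ) {γ : ℝ} (hγ : γ < 0) :
    ENNReal.ofReal (|t| ^ γ) ≤ ‖t‖ₑ ^ γ := by
  rw [Real.enorm_eq_ofReal_abs]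
  rcases eq_or_ne t 0 with rfl | ht
  · simp [ENNReal.zero_rpow_of_neg hγ]
  · rw [ENNReal.ofReal_rpow_of_pos (abs_pos.2 ht)]

lemma enorm_rpow_eq_ofReal {t : ℝ} (ht : t ≠ 0) (γ : ℝ) :
    ‖t‖ₑ ^ γ = ENNReal.ofReal (|t| ^ γ) := by
  rw [Real.enorm_eq_ofReal_abs, ENNReal.ofReal_rpow_of_pos (abs_pos.2 ht)]

lemma ennreal_rpow_le_rpow_of_nonpos {a b : ℝ≥0∞} {γ : ℝ} (hab : a ≤ b) (hγ : γ ≤ 0) :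
    b ^ γ ≤ a ^ γ := by
  rw [← neg_neg γ, ENNReal.rpow_neg, ENNReal.rpow_neg a]
  exact ENNReal.inv_le_inv.2 (ENNReal.rpow_le_rpow hab (neg_nonneg.2 hγ))

lemma lintegral_Ioc_enorm_rpow {γ : ℝ} (hγ : -1 < γ) {r : ℝ} (hr : 0 < r) :
    ∫⁻ s in Ioc 0 r, ‖s‖ₑ ^ γ = ENNReal.ofReal (r ^ (γ + 1) / (γ + 1)) := by
  have h1 : ∫⁻ s in Ioc 0 r, ‖s‖ₑ ^ γ = ∫⁻ s in Ioc 0 r, ENNReal.ofReal (s ^ γ) := by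
    refine setLIntegral_congr_fun measurableSet_Ioc fun s hs => ?_
    simp only [enorm_rpow_eq_ofReal hs.1.ne', abs_of_pos hs.1]
  have hint : IntegrableOn (fun s : ℝ => s ^ γ) (Ioc 0 r) :=
    (intervalIntegral.intervalIntegrable_rpow' hγ (a := 0) (b := r)).1
  rw [h1, ← ofReal_integral_eq_lintegral_ofReal hint, ← intervalIntegral.integral_of_le hr.le,
    integral_rpow (Or.inl hγ), Real.zero_rpow (by linarith), sub_zero]
  refine (ae_restrict_iff' measurableSet_Ioc).2 (Filter.Eventually.of_forall fun s hs => ?_)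
  exact Real.rpow_nonneg hs.1.le _

lemma lintegral_Ioo_symm_enorm_rpow_le {γ : ℝ} (hγ : -1 < γ) {r : ℝ} (hr : 0 < r) :
    ∫⁻ s in Ioo (-r) r, ‖s‖ₑ ^ γ ≤ ENNReal.ofReal (2 * (r ^ (γ + 1) / (γ + 1))) := by
  have hsub : Ioo (-r) r ⊆ ({0} ∪ Ioc 0 r) ∪ Neg.neg ⁻¹' Ioc 0 r := by
    intro s hs
    rcases lt_trichotomy s 0 with h | h | h
    · exact Or.inr ⟨by linarith, by linarith [hs.1]⟩
    · exact Or.inl (Or.inl h)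
    · exact Or.inl (Or.inr ⟨h, hs.2.le⟩)
  have hneg : ∫⁻ s in Neg.neg ⁻¹' Ioc 0 r, ‖s‖ₑ ^ γ = ∫⁻ s in Ioc 0 r, ‖s‖ₑ ^ γ := by
    have := (Measure.measurePreserving_neg (volume : Measure ℝ)).setLIntegral_comp_preimage
      (s := Ioc 0 r) measurableSet_Ioc (f := fun s : ℝ => ‖s‖ₑ ^ γ) (by fun_prop)
    simpa only [enorm_neg] using this
  have h0 : (0 : ℝ) ≤ r ^ (γ + 1) / (γ + 1) :=
    div_nonneg (Real.rpow_nonneg hr.le _) (by linarith)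
  calc ∫⁻ s in Ioo (-r) r, ‖s‖ₑ ^ γ
      ≤ ∫⁻ s in ({0} ∪ Ioc 0 r) ∪ Neg.neg ⁻¹' Ioc 0 r, ‖s‖ₑ ^ γ := lintegral_mono_set hsub
    _ ≤ ((∫⁻ s in ({0} : Set ℝ), ‖s‖ₑ ^ γ) + ∫⁻ s in Ioc 0 r, ‖s‖ₑ ^ γ)
        + ∫⁻ s in Neg.neg ⁻¹' Ioc 0 r, ‖s‖ₑ ^ γ :=
      (lintegral_union_le _ _ _).trans (add_le_add_left (lintegral_union_le _ _ _) _)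
    _ = ENNReal.ofReal (2 * (r ^ (γ + 1) / (γ + 1))) := by
      rw [hneg, setLIntegral_measure_zero _ _ (by simp), zero_add, lintegral_Ioc_enorm_rpow hγ hr,
        ← ENNReal.ofReal_add h0 h0, two_mul]

lemma lintegral_Ioo_enorm_rpow_le {γ : ℝ} (hγ : -1 < γ) (hγ' : γ < 0) (a : ℝ) {r : ℝ}
    (hr : 0 < r) :
    ∫⁻ s in Ioo (a - r) (a + r), ‖s‖ₑ ^ γ
      ≤ ENNReal.ofReal ((2 + 2 / (γ + 1)) * r ^ (γ + 1)) := by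
  have hpt : ∀ s : ℝ, ‖s‖ₑ ^ γ
      ≤ ENNReal.ofReal (r ^ γ) + (Ioo (-r) r).indicator (fun s => ‖s‖ₑ ^ γ) s := by
    intro s
    by_cases hs : s ∈ Ioo (-r) r
    · rw [indicator_of_mem hs]
      exact le_add_self
    · rw [indicator_of_notMem hs, add_zero, ← ENNReal.ofReal_rpow_of_pos hr,
        Real.enorm_eq_ofReal_abs]
      refine ennreal_rpow_le_rpow_of_nonpos (ENNReal.ofReal_le_ofReal ?_) hγ'.le
      by_contra! h
      exact hs (abs_lt.1 h)
  have hr1 : r ^ (γ + 1) = r ^ γ * r := by rw [Real.rpow_add hr, Real.rpow_one]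
  have h1 : 0 < γ + 1 := by linarith
  calc ∫⁻ s in Ioo (a - r) (a + r), ‖s‖ₑ ^ γ
      ≤ ∫⁻ s in Ioo (a - r) (a + r), (ENNReal.ofReal (r ^ γ)
          + (Ioo (-r) r).indicator (fun s => ‖s‖ₑ ^ γ) s) := lintegral_mono hpt
    _ = ENNReal.ofReal (r ^ γ) * ENNReal.ofReal (2 * r)
        + ∫⁻ s in Ioo (a - r) (a + r), (Ioo (-r) r).indicator (fun s => ‖s‖ₑ ^ γ) s := by
      rw [lintegral_add_left measurable_const, setLIntegral_const, Real.volume_Ioo]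
      congr 3; ring
    _ ≤ ENNReal.ofReal (r ^ γ) * ENNReal.ofReal (2 * r)
        + ENNReal.ofReal (2 * (r ^ (γ + 1) / (γ + 1))) := by
      gcongr
      refine (setLIntegral_le_lintegral _ _).trans ?_
      rw [lintegral_indicator measurableSet_Ioo]
      exact lintegral_Ioo_symm_enorm_rpow_le hγ hr
    _ = ENNReal.ofReal ((2 + 2 / (γ + 1)) * r ^ (γ + 1)) := by
      rw [← ENNReal.ofReal_mul (by positivity), ← ENNReal.ofReal_add (by positivity) (by positivity)]
      congr 1
      rw [hr1]; field_simp

/-- A negative power, larger than `-1`, of the distance to a line through the origin, integrated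
over a ball. -/
lemma lintegral_ball_enorm_inner_rpow_le {γ : ℝ} (hγ : -1 < γ) (hγ' : γ < 0) {n : E2}
    (hn : ‖n‖ = 1) (x : E2) {r : ℝ} (hr : 0 < r) :
    ∫⁻ y in Metric.ball x r, ‖(inner ℝ n y : ℝ)‖ₑ ^ γ
      ≤ ENNReal.ofReal (2 * (2 + 2 / (γ + 1)) * (r ^ 2 * r ^ γ)) := by
  obtain ⟨b, hb⟩ : ∃ b : OrthonormalBasis (Fin 2) ℝ E2, ∀ i ∈ ({1} : Set (Fin 2)), b i = n := by
    refine Orthonormal.exists_orthonormalBasis_extension_of_card_eq (v := fun _ => n) (by simp) ?_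
    refine ⟨fun _ => hn, fun i j hij => absurd (Subsingleton.elim i j) hij⟩
  have hb1 : b 1 = n := hb 1 rfl
  set g : E2 → ℝ × ℝ := fun y => (inner ℝ (b 0) y, inner ℝ (b 1) y) with hg
  have hmp : MeasurePreserving g volume volume := by
    have := ((volume_preserving_finTwoArrow ℝ).comp
      (PiLp.volume_preserving_ofLp (Fin 2))).comp b.measurePreserving_repr
    convert this using 1
    ext y <;> simp [hg, b.repr_apply_apply, MeasurableEquiv.finTwoArrow]
  set S : Set (ℝ × ℝ) := Ioo ((g x).1 - r) ((g x).1 + r) ×ˢ Ioo ((g x).2 - r) ((g x).2 + r)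
    with hS
  have hsub : Metric.ball x r ⊆ g ⁻¹' S := by
    intro y hy
    rw [Metric.mem_ball, dist_eq_norm] at hy
    have key : ∀ i, |inner ℝ (b i) y - inner ℝ (b i) x| < r := fun i => by
      rw [← inner_sub_right]
      refine (abs_real_inner_le_norm _ _).trans_lt ?_
      simpa using hy
    have h0 := abs_lt.1 (key 0)
    have h1 := abs_lt.1 (key 1)
    exact ⟨⟨by simp only [hg]; linarith, by simp only [hg]; linarith⟩,
      ⟨by simp only [hg]; linarith, by simp only [hg]; linarith⟩⟩
  have hr1 : r ^ (γ + 1) = r ^ γ * r := by rw [Real.rpow_add hr, Real.rpow_one]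
  have h1 : 0 < γ + 1 := by linarith
  calc ∫⁻ y in Metric.ball x r, ‖(inner ℝ n y : ℝ)‖ₑ ^ γ
      ≤ ∫⁻ y in g ⁻¹' S, ‖(g y).2‖ₑ ^ γ := by
        rw [← hb1]; exact lintegral_mono_set hsub
    _ = ∫⁻ p in S, ‖p.2‖ₑ ^ γ :=
        hmp.setLIntegral_comp_preimage (measurableSet_Ioo.prod measurableSet_Ioo)
          (f := fun p : ℝ × ℝ => ‖p.2‖ₑ ^ γ) (by fun_prop)
    _ = (∫⁻ s in Ioo ((g x).2 - r) ((g x).2 + r), ‖s‖ₑ ^ γ) * ENNReal.ofReal (2 * r) := by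
        rw [hS, Measure.volume_eq_prod, setLIntegral_prod _ (by fun_prop)]
        simp only [setLIntegral_const, Real.volume_Ioo]
        congr 2; ring
    _ ≤ ENNReal.ofReal ((2 + 2 / (γ + 1)) * r ^ (γ + 1)) * ENNReal.ofReal (2 * r) := by
        gcongr
        exact lintegral_Ioo_enorm_rpow_le hγ hγ' _ hr
    _ = ENNReal.ofReal (2 * (2 + 2 / (γ + 1)) * (r ^ 2 * r ^ γ)) := by
        rw [← ENNReal.ofReal_mul (by positivity)]
        congr 1
        rw [hr1]; ring

lemma volume_ball_E2 (x : E2) {r : ℝ} (hr : 0 ≤ r) :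
    volume (Metric.ball x r) = ENNReal.ofReal (π * r ^ 2) := by
  rw [EuclideanSpace.volume_ball_fin_two, mul_comm, ENNReal.ofReal_mul Real.pi_pos.le,
    ENNReal.ofReal_pow hr]

lemma lintegral_ball_le_of_le {f : E2 → ℝ} {M : ℝ} (hM : 0 ≤ M) {x : E2} {r : ℝ} (hr : 0 < r)
    (h : ∀ y ∈ Metric.ball x r, f y ≤ M) :
    ∫⁻ y in Metric.ball x r, ENNReal.ofReal (f y) ≤ ENNReal.ofReal (M * (π * r ^ 2)) := by
  refine (setLIntegral_mono' measurableSet_ball fun y hy =>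
    ENNReal.ofReal_le_ofReal (h y hy)).trans ?_
  rw [setLIntegral_const, volume_ball_E2 x hr.le, ← ENNReal.ofReal_mul hM]

/-- The integral over balls of a power, larger than `-1`, of the distance to the boundary. -/
lemma exists_lintegral_ball_rhoD_rpow_le {κ : ℝ} (hκ : 0 < κ) (hκ' : κ < 2 * π) {γ : ℝ}
    (hγ : -1 < γ) : ∃ C : ℝ, 0 < C ∧ ∀ (x : E2) (r : ℝ), 0 < r →
      ∫⁻ y in Metric.ball x r, ENNReal.ofReal (rhoD κ y ^ γ)
        ≤ ENNReal.ofReal (C * (r ^ 2 * (rhoD κ x + r) ^ γ)) := by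
  rcases le_or_gt 0 γ with h0 | h0
  · refine ⟨π, Real.pi_pos, fun x r hr => ?_⟩
    have hx := rhoD_nonneg κ x
    refine (lintegral_ball_le_of_le (M := (rhoD κ x + r) ^ γ) (by positivity) hr
      fun y hy => ?_).trans_eq (by congr 1; ring)
    rw [Metric.mem_ball] at hy
    exact Real.rpow_le_rpow (rhoD_nonneg κ y) (by linarith [rhoD_le_add_dist κ y x]) h0
  · have h1 : 0 < γ + 1 := by linarith
    set M : ℝ := 2 * (2 + 2 / (γ + 1)) with hM
    have hMpos : 0 < M := by positivity
    have hpi := Real.pi_pos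
    refine ⟨(π + 2 * M) * 3 ^ |γ|, by positivity, fun x r hr => ?_⟩
    have hx := rhoD_nonneg κ x
    rcases le_total (2 * r) (rhoD κ x) with hrx | hrx
    · refine (lintegral_ball_le_of_le (M := 3 ^ |γ| * (rhoD κ x + r) ^ γ) (by positivity) hr
        fun y hy => ?_).trans (ENNReal.ofReal_le_ofReal ?_)
      · rw [Metric.mem_ball] at hy
        have h2 := rhoD_le_add_dist κ y x
        have h3 := rhoD_le_add_dist κ x y
        rw [dist_comm] at h3
        exact rpow_le_mul_rpow (by linarith) (by linarith) (by linarith) (by linarith) _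
      · have : 0 ≤ 2 * M * (3 ^ |γ| * (r ^ 2 * (rhoD κ x + r) ^ γ)) := by positivity
        linarith
    · have hpt : ∀ y : E2, ENNReal.ofReal (rhoD κ y ^ γ)
          ≤ ‖(inner ℝ normalZero y : ℝ)‖ₑ ^ γ + ‖(inner ℝ (normalAngle κ) y : ℝ)‖ₑ ^ γ := by
        intro y
        have h2 := ofReal_rpow_le_enorm_rpow (rhoD κ y) h0
        rw [abs_of_nonneg (rhoD_nonneg κ y)] at h2
        refine h2.trans ?_
        rcases min_le_iff.1 (min_abs_inner_le_rhoD hκ hκ' y) with h | h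
        · refine le_add_right (ennreal_rpow_le_rpow_of_nonpos ?_ h0.le)
          rw [Real.enorm_eq_ofReal_abs, Real.enorm_of_nonneg (rhoD_nonneg κ y)]
          exact ENNReal.ofReal_le_ofReal h
        · refine le_add_left (ennreal_rpow_le_rpow_of_nonpos ?_ h0.le)
          rw [Real.enorm_eq_ofReal_abs, Real.enorm_of_nonneg (rhoD_nonneg κ y)]
          exact ENNReal.ofReal_le_ofReal h
      refine (lintegral_mono hpt).trans ?_
      rw [lintegral_add_left (by fun_prop)]
      refine (add_le_add (lintegral_ball_enorm_inner_rpow_le hγ h0 norm_normalZero x hr)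
        (lintegral_ball_enorm_inner_rpow_le hγ h0 (norm_normalAngle κ) x hr)).trans ?_
      rw [← ENNReal.ofReal_add (by positivity) (by positivity)]
      refine ENNReal.ofReal_le_ofReal ?_
      have h2 : r ^ γ ≤ 3 ^ |γ| * (rhoD κ x + r) ^ γ :=
        rpow_le_mul_rpow hr (by linarith) (by linarith) (by linarith) _
      have h3 := mul_le_mul_of_nonneg_left h2 (by positivity : 0 ≤ 2 * M * r ^ 2)
      have : 0 ≤ π * (3 ^ |γ| * (r ^ 2 * (rhoD κ x + r) ^ γ)) := by positivity
      linarith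

lemma lintegral_wgt_le_of_norm_comparable {κ γ ν K T : ℝ} {A : Set E2} (hA : MeasurableSet A)
    (hK : 0 ≤ K) (hT : 0 < T)
    (h : ∀ y ∈ A, 0 < ‖y‖ ∧ ‖y‖ ≤ K * T ∧ T ≤ K * ‖y‖) :
    ∫⁻ y in A, ENNReal.ofReal (wgt κ γ ν y)
      ≤ ENNReal.ofReal (K ^ |ν - γ| * T ^ (ν - γ)) * ∫⁻ y in A, ENNReal.ofReal (rhoD κ y ^ γ) := by
  rw [← lintegral_const_mul' _ _ ENNReal.ofReal_ne_top]
  refine setLIntegral_mono' hA fun y hy => ?_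
  obtain ⟨h1, h2, h3⟩ := h y hy
  rw [← ENNReal.ofReal_mul (by positivity)]
  refine ENNReal.ofReal_le_ofReal ?_
  exact mul_le_mul_of_nonneg_right (rpow_le_mul_rpow h1 hT h2 h3 _)
    (Real.rpow_nonneg (rhoD_nonneg _ _) _)

/-- The weight integrated over balls around the vertex. -/
lemma exists_lintegral_ball_zero_wgt_le {κ : ℝ} (hκ : 0 < κ) (hκ' : κ < 2 * π) {γ ν : ℝ}
    (hγ : -1 < γ) (hν : -2 < ν) : ∃ C : ℝ, 0 < C ∧ ∀ R : ℝ, 0 < R →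
      ∫⁻ y in Metric.ball (0 : E2) R, ENNReal.ofReal (wgt κ γ ν y)
        ≤ ENNReal.ofReal (C * R ^ (ν + 2)) := by
  obtain ⟨C, hC, hball⟩ := exists_lintegral_ball_rhoD_rpow_le hκ hκ' hγ
  set q : ℝ := (1 / 2) ^ (ν + 2) with hq
  have hq0 : 0 < q := by positivity
  have hq1 : q < 1 := Real.rpow_lt_one (by norm_num) (by norm_num) (by linarith)
  refine ⟨2 ^ |ν - γ| * C * (1 - q)⁻¹, mul_pos (by positivity) (inv_pos.2 (by linarith)),
    fun R hR => ?_⟩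
  set A : ℕ → Set E2 := fun k =>
    {y | R * (1 / 2) ^ (k + 1) ≤ ‖y‖ ∧ ‖y‖ < R * (1 / 2) ^ k} with hA
  have hAm : ∀ k, MeasurableSet (A k) := fun k =>
    (measurableSet_le measurable_const measurable_norm).inter
      (measurableSet_lt measurable_norm measurable_const)
  have hsub : Metric.ball (0 : E2) R ⊆ {0} ∪ ⋃ k, A k := by
    intro y hy
    rw [mem_ball_zero_iff] at hy
    rcases eq_or_ne y 0 with h | h
    · exact Or.inl h
    · right
      have hy0 : 0 < ‖y‖ := norm_pos_iff.2 h
      have hex : ∃ k : ℕ, R * (1 / 2) ^ (k + 1) ≤ ‖y‖ := by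
        obtain ⟨k, hk⟩ := exists_pow_lt_of_lt_one (div_pos hy0 hR)
          (by norm_num : (1 / 2 : ℝ) < 1)
        refine ⟨k, ?_⟩
        rw [lt_div_iff₀ hR] at hk
        have : 0 < R * (1 / 2 : ℝ) ^ k := by positivity
        rw [pow_succ]
        linarith
      classical
      refine mem_iUnion.2 ⟨Nat.find hex, Nat.find_spec hex, ?_⟩
      rcases Nat.eq_zero_or_pos (Nat.find hex) with h0 | h0
      · rw [h0]; simpa using hy
      · have := Nat.find_min hex (Nat.sub_lt h0 one_pos)
        rw [Nat.sub_add_cancel (Nat.one_le_of_lt h0)] at this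
        exact not_le.1 this
  have hk : ∀ k, ∫⁻ y in A k, ENNReal.ofReal (wgt κ γ ν y)
      ≤ ENNReal.ofReal (2 ^ |ν - γ| * C * R ^ (ν + 2)) * ENNReal.ofReal q ^ k := by
    intro k
    set T : ℝ := R * (1 / 2) ^ k with hT
    have hT0 : 0 < T := by positivity
    have hTpow : T ^ (ν + 2) = R ^ (ν + 2) * q ^ k := by
      rw [hT, Real.mul_rpow hR.le (by positivity), hq, ← Real.rpow_natCast, ← Real.rpow_natCast,
        ← Real.rpow_mul (by norm_num), ← Real.rpow_mul (by norm_num), mul_comm (ν + 2)]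
    refine (lintegral_wgt_le_of_norm_comparable (K := 2) (T := T) (hAm k) (by norm_num) hT0
      fun y hy => ?_).trans ?_
    · have h1 : T / 2 ≤ ‖y‖ := by
        refine le_trans (le_of_eq ?_) hy.1
        rw [hT, pow_succ]; ring
      have h2 : ‖y‖ < T := hy.2
      exact ⟨by linarith, by linarith, by linarith⟩
    · have hsubT : A k ⊆ Metric.ball (0 : E2) T := fun y hy => mem_ball_zero_iff.2 hy.2
      refine (mul_le_mul_right ((lintegral_mono_set hsubT).trans (hball 0 T hT0)) _).trans_eq ?_
      rw [rhoD_zero hκ hκ', zero_add, ← ENNReal.ofReal_pow hq0.le,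
        ← ENNReal.ofReal_mul (by positivity), ← ENNReal.ofReal_mul (by positivity)]
      congr 1
      have : T ^ (ν + 2) = T ^ (ν - γ) * T ^ γ * T ^ 2 := by
        rw [← Real.rpow_add hT0, ← Real.rpow_natCast T 2, ← Real.rpow_add hT0]
        congr 1; push_cast; ring
      rw [mul_assoc _ (R ^ (ν + 2)), ← hTpow, this]; ring
  calc ∫⁻ y in Metric.ball (0 : E2) R, ENNReal.ofReal (wgt κ γ ν y)
      ≤ ∫⁻ y in {0} ∪ ⋃ k, A k, ENNReal.ofReal (wgt κ γ ν y) := lintegral_mono_set hsub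
    _ ≤ (∫⁻ y in ({0} : Set E2), ENNReal.ofReal (wgt κ γ ν y))
        + ∫⁻ y in ⋃ k, A k, ENNReal.ofReal (wgt κ γ ν y) := lintegral_union_le _ _ _
    _ = ∫⁻ y in ⋃ k, A k, ENNReal.ofReal (wgt κ γ ν y) := by
      rw [setLIntegral_measure_zero _ _ (by simp), zero_add]
    _ ≤ ∑' k, ∫⁻ y in A k, ENNReal.ofReal (wgt κ γ ν y) := lintegral_iUnion_le _ _
    _ ≤ ∑' k, ENNReal.ofReal (2 ^ |ν - γ| * C * R ^ (ν + 2)) * ENNReal.ofReal q ^ k :=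
      ENNReal.tsum_le_tsum hk
    _ = ENNReal.ofReal (2 ^ |ν - γ| * C * (1 - q)⁻¹ * R ^ (ν + 2)) := by
      rw [ENNReal.tsum_mul_left, ENNReal.tsum_geometric, ← ENNReal.ofReal_one,
        ← ENNReal.ofReal_sub _ hq0.le, ← ENNReal.ofReal_inv_of_pos (by linarith),
        ← ENNReal.ofReal_mul (by positivity)]
      congr 1; ring

lemma exists_wMeas_ballD_le {κ : ℝ} (hκ : 0 < κ) (hκ' : κ < 2 * π) {γ ν : ℝ}
    (hγ : -1 < γ) (hν : -2 < ν) : ∃ C : ℝ, 0 < C ∧ ∀ (x : E2) (r : ℝ), 0 < r →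
      wMeas κ γ ν (ballD κ x r)
        ≤ ENNReal.ofReal (C * (r ^ 2 * (‖x‖ + r) ^ (ν - γ) * (rhoD κ x + r) ^ γ)) := by
  obtain ⟨C₁, hC₁, hball⟩ := exists_lintegral_ball_rhoD_rpow_le hκ hκ' hγ
  obtain ⟨C₂, hC₂, hzero⟩ := exists_lintegral_ball_zero_wgt_le hκ hκ' hγ hν
  refine ⟨3 ^ |ν - γ| * C₁ + C₂ * 3 ^ (ν + 2) * (3 ^ |ν - γ| * 3 ^ |γ|), by positivity,
    fun x r hr => ?_⟩
  have hx := rhoD_nonneg κ x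
  have hxn := rhoD_le_norm hκ hκ' x
  have hsub : ballD κ x r ⊆ Metric.ball x r := fun y hy => hy.2
  refine (lintegral_mono_set hsub).trans ?_
  rcases le_total (2 * r) ‖x‖ with h | h
  · refine (lintegral_wgt_le_of_norm_comparable (K := 3) (T := ‖x‖ + r) measurableSet_ball
      (by norm_num) (by positivity) fun y hy => ?_).trans ?_
    · rw [Metric.mem_ball, dist_eq_norm] at hy
      have h1 := norm_sub_norm_le y x
      have h2 := norm_sub_norm_le x y
      rw [norm_sub_rev] at h2
      exact ⟨by linarith, by linarith, by linarith⟩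
    · refine (mul_le_mul_right (hball x r hr) _).trans ?_
      rw [← ENNReal.ofReal_mul (by positivity)]
      refine ENNReal.ofReal_le_ofReal ?_
      have : 0 ≤ C₂ * 3 ^ (ν + 2) * (3 ^ |ν - γ| * 3 ^ |γ|)
        * (r ^ 2 * (‖x‖ + r) ^ (ν - γ) * (rhoD κ x + r) ^ γ) := by positivity
      linarith
  · have hsub' : Metric.ball x r ⊆ Metric.ball (0 : E2) (3 * r) := by
      refine Metric.ball_subset_ball' ?_
      rw [dist_zero_right]; linarith
    refine (lintegral_mono_set hsub').trans ((hzero (3 * r) (by positivity)).trans ?_)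
    refine ENNReal.ofReal_le_ofReal ?_
    have h1 : r ^ (ν - γ) ≤ 3 ^ |ν - γ| * (‖x‖ + r) ^ (ν - γ) :=
      rpow_le_mul_rpow hr (by positivity) (by linarith [norm_nonneg x]) (by linarith) _
    have h2 : r ^ γ ≤ 3 ^ |γ| * (rhoD κ x + r) ^ γ :=
      rpow_le_mul_rpow hr (by positivity) (by linarith) (by linarith) _
    have hr2 : r ^ (ν + 2) = r ^ 2 * (r ^ (ν - γ) * r ^ γ) := by
      rw [← Real.rpow_add hr, ← Real.rpow_natCast r 2, ← Real.rpow_add hr]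
      congr 1; push_cast; ring
    rw [Real.mul_rpow (by norm_num) hr.le, hr2]
    have h3 := mul_le_mul_of_nonneg_left
      (mul_le_mul h1 h2 (by positivity) (by positivity))
      (by positivity : 0 ≤ C₂ * 3 ^ (ν + 2) * r ^ 2)
    have : 0 ≤ 3 ^ |ν - γ| * C₁
      * (r ^ 2 * (‖x‖ + r) ^ (ν - γ) * (rhoD κ x + r) ^ γ) := by positivity
    linarith

lemma exists_le_wMeas_ballD {κ : ℝ} (hκ : 0 < κ) (hκ' : κ < 2 * π) (γ ν : ℝ) :
    ∃ c : ℝ, 0 < c ∧ ∀ x ∈ Dset κ, ∀ r : ℝ, 0 < r →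
      ENNReal.ofReal (c * (r ^ 2 * (‖x‖ + r) ^ (ν - γ) * (rhoD κ x + r) ^ γ))
        ≤ wMeas κ γ ν (ballD κ x r) := by
  set δ : ℝ := Real.sin (κ / 2) / 4 with hδ
  have hsin : 0 < Real.sin (κ / 2) := Real.sin_pos_of_pos_of_lt_pi (by linarith) (by linarith)
  have hδ0 : 0 < δ := by positivity
  have hδ1 : δ ≤ 1 / 4 := by linarith [Real.sin_le_one (κ / 2)]
  have hpi := Real.pi_pos
  set K : ℝ := 3 / δ with hK
  have hK0 : 0 < K := by positivity
  have hK1 : 1 ≤ K := by rw [hK, le_div_iff₀ hδ0]; linarith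
  have hcmp : ∀ {s t r : ℝ}, 0 ≤ t → 0 < r → δ * r ≤ s → t - r ≤ s → t + r ≤ K * s := by
    intro s t r ht hr h1 h2
    rw [hK, div_mul_eq_mul_div, le_div_iff₀ hδ0]
    rcases le_total t (2 * r) with h | h
    · nlinarith
    · nlinarith
  refine ⟨(K ^ |ν - γ|)⁻¹ * (K ^ |γ|)⁻¹ * (π * δ ^ 2), by positivity, fun x hx r hr => ?_⟩
  set z : E2 := x + (r / 2) • bisector κ with hz
  have hxr := rhoD_nonneg κ x
  have hzball := ball_add_smul_bisector_subset hκ hκ' hx (r / 2)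
  have hzrho := le_rhoD_of_ball_subset hκ hκ' hzball
  have hzx : dist z x = r / 2 := by
    rw [dist_eq_norm, hz, add_sub_cancel_left, norm_smul, norm_bisector, mul_one,
      Real.norm_of_nonneg (by positivity)]
  have hrad : r / 2 * Real.sin (κ / 2) = 2 * (δ * r) := by rw [hδ]; ring
  rw [hrad] at hzball hzrho
  have hδr : 0 < δ * r := by positivity
  have hyx : ∀ y ∈ Metric.ball z (δ * r), dist y x < r := fun y hy => by
    rw [Metric.mem_ball] at hy
    have := dist_triangle y z x
    nlinarith
  have hsub : Metric.ball z (δ * r) ⊆ ballD κ x r := fun y hy =>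
    ⟨hzball (Metric.ball_subset_ball (by linarith) hy), hyx y hy⟩
  refine le_trans ?_ (lintegral_mono_set hsub)
  have hpt : ∀ y ∈ Metric.ball z (δ * r),
      ENNReal.ofReal ((K ^ |ν - γ|)⁻¹ * (‖x‖ + r) ^ (ν - γ)
        * ((K ^ |γ|)⁻¹ * (rhoD κ x + r) ^ γ)) ≤ ENNReal.ofReal (wgt κ γ ν y) := by
    intro y hy
    have hd := hyx y hy
    rw [Metric.mem_ball] at hy
    have hy1 := rhoD_le_add_dist κ z y
    rw [dist_comm] at hy1
    have hyr : δ * r ≤ rhoD κ y := by linarith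
    have hyn := rhoD_le_norm hκ hκ' y
    have h1 := rhoD_le_add_dist κ x y
    rw [dist_comm] at h1
    have h2 := rhoD_le_add_dist κ y x
    have h3 := norm_sub_norm_le y x
    have h4 := norm_sub_norm_le x y
    rw [norm_sub_rev] at h4
    rw [← dist_eq_norm] at h3 h4
    have hxn := norm_nonneg x
    have hn := rpow_le_mul_rpow (K := K) (s := ‖x‖ + r) (t := ‖y‖) (by linarith) (by linarith)
      (hcmp hxn hr (by linarith) (by linarith)) (by nlinarith) (ν - γ)
    have hd := rpow_le_mul_rpow (K := K) (s := rhoD κ x + r) (t := rhoD κ y) (by linarith)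
      (by linarith) (hcmp hxr hr (by linarith) (by linarith)) (by nlinarith) γ
    refine ENNReal.ofReal_le_ofReal (mul_le_mul ?_ ?_ (by positivity) (by positivity))
    · rwa [inv_mul_le_iff₀ (by positivity)]
    · rwa [inv_mul_le_iff₀ (by positivity)]
  refine le_trans (le_of_eq ?_) (setLIntegral_mono' measurableSet_ball hpt)
  rw [setLIntegral_const, volume_ball_E2 z hδr.le, ← ENNReal.ofReal_mul (by positivity)]
  congr 1; ring

theorem stmt5 (κ : ℝ) (hκ : 0 < κ) (hκ' : κ < 2 * π)
    (γ ν : ℝ) (hγ : -1 < γ) (hν : -2 < ν) :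
    ∃ c C : ℝ, 0 < c ∧ c ≤ C ∧ ∀ x ∈ Dset κ, ∀ r : ℝ, 0 < r →
      ENNReal.ofReal (c * (r ^ 2 * (‖x‖ + r) ^ (ν - γ) * (rhoD κ x + r) ^ γ))
          ≤ wMeas κ γ ν (ballD κ x r) ∧
      wMeas κ γ ν (ballD κ x r)
          ≤ ENNReal.ofReal (C * (r ^ 2 * (‖x‖ + r) ^ (ν - γ) * (rhoD κ x + r) ^ γ)) := by
  obtain ⟨C, hC, hupper⟩ := exists_wMeas_ballD_le hκ hκ' hγ hν
  obtain ⟨c, hc, hlower⟩ := exists_le_wMeas_ballD hκ hκ' γ ν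
  refine ⟨c, max c C, hc, le_max_left _ _, fun x hx r hr => ⟨hlower x hx r hr, ?_⟩⟩
  have hx0 := rhoD_nonneg κ x
  refine (hupper x r hr).trans (ENNReal.ofReal_le_ofReal ?_)
  exact mul_le_mul_of_nonneg_right (le_max_right _ _) (by positivity)
end
end

section
/- Let γ ∈ (−1, ∞) and ν ∈ (−2, ∞). Then there exist constants 0 < c ≤ C < ∞, depending only on γ, ν and κ, such that for all x ∈ 𝒟 and all r > 0: c · I(x, r) ≤ w_{γ,ν}(S(x, r)) ≤ C · I(x, r), where I(x, r) = ( ∫_{max(|x|−r, 0)}^{|x|+r} s^{ν+1} ds ) · ( ∫_{max(Arg(x)−r/|x|, 0)}^{min(Arg(x)+r/|x|, κ)} min(φ, κ−φ)^{γ} dφ ) and Arg(x) ∈ (0, κ) denotes the unique angle with x = |x| (cos Arg(x), sin Arg(x)). -/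
open MeasureTheory Set Real
open scoped ENNReal

noncomputable section

/-- The point of the plane with polar coordinates `(s, φ)`. -/
def pol (s φ : ℝ) : E2 := !₂[s * Real.cos φ, s * Real.sin φ]

@[simp] lemma pol_apply_zero (s φ : ℝ) : pol s φ 0 = s * Real.cos φ := rfl

@[simp] lemma pol_apply_one (s φ : ℝ) : pol s φ 1 = s * Real.sin φ := rfl

lemma eq_pol_iff {x : E2} {s φ : ℝ} :
    x = pol s φ ↔ x 0 = s * Real.cos φ ∧ x 1 = s * Real.sin φ := by
  constructor
  · rintro rfl
    simp
  · rintro ⟨h0, h1⟩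
    ext i
    fin_cases i
    · simpa using h0
    · simpa using h1

lemma inner_pol (s φ t θ : ℝ) :
    inner ℝ (pol s φ) (pol t θ) = s * t * Real.cos (φ - θ) := by
  rw [PiLp.inner_apply, Fin.sum_univ_two, Real.cos_sub]
  simp only [pol_apply_zero, pol_apply_one, RCLike.inner_apply, conj_trivial]
  ring

lemma norm_pol {s : ℝ} (hs : 0 ≤ s) (φ : ℝ) : ‖pol s φ‖ = s := by
  have h : ‖pol s φ‖ ^ 2 = s ^ 2 := by
    rw [← real_inner_self_eq_norm_sq, inner_pol, sub_self, Real.cos_zero]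
    ring
  exact (pow_left_inj₀ (norm_nonneg _) hs two_ne_zero).1 h

lemma smul_pol (a s φ : ℝ) : a • pol s φ = pol (a * s) φ := by
  rw [eq_pol_iff]
  simp [mul_assoc]

lemma exists_eq_pol (x : E2) (α : ℝ) : ∃ φ ∈ Ioc (α - π) (α + π), x = pol ‖x‖ φ := by
  let z : ℂ := ⟨x 0, x 1⟩
  have hz : ‖z‖ = ‖x‖ := by
    rw [EuclideanSpace.norm_eq, Fin.sum_univ_two, Complex.norm_def, Complex.normSq_apply]
    simp [z, pow_two]
  refine ⟨toIocMod Real.two_pi_pos (α - π) z.arg, ?_, ?_⟩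
  · have h := toIocMod_mem_Ioc Real.two_pi_pos (α - π) z.arg
    rwa [show α - π + 2 * π = α + π by ring] at h
  · rw [eq_pol_iff, ← self_sub_toIocDiv_zsmul, zsmul_eq_mul, Real.cos_sub_int_mul_two_pi,
      Real.sin_sub_int_mul_two_pi, ← hz, Complex.norm_mul_cos_arg, Complex.norm_mul_sin_arg]
    exact ⟨rfl, rfl⟩

lemma mem_Dset_iff_exists {κ : ℝ} {x : E2} :
    x ∈ Dset κ ↔ ∃ s φ : ℝ, 0 < s ∧ 0 < φ ∧ φ < κ ∧ x = pol s φ := by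
  simp only [eq_pol_iff]
  rfl

lemma pol_mem_Dset {κ s φ : ℝ} (hs : 0 < s) (h0 : 0 < φ) (h1 : φ < κ) : pol s φ ∈ Dset κ :=
  mem_Dset_iff_exists.2 ⟨s, φ, hs, h0, h1, rfl⟩

/-- The angular domain is an open cone around its bisector. -/
lemma mem_Dset_iff {κ : ℝ} (hκ : 0 < κ) (hκ' : κ < 2 * π) {x : E2} :
    x ∈ Dset κ ↔ Real.cos (κ / 2) * ‖x‖ < inner ℝ x (pol 1 (κ / 2)) := by
  constructor
  · rw [mem_Dset_iff_exists]
    rintro ⟨s, φ, hs, h0, h1, rfl⟩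
    rw [norm_pol hs.le, inner_pol, mul_one, mul_comm]
    refine mul_lt_mul_of_pos_left ?_ hs
    rw [← Real.cos_abs (φ - κ / 2)]
    refine Real.cos_lt_cos_of_nonneg_of_le_pi (abs_nonneg _) (by linarith) ?_
    rw [abs_lt]
    constructor <;> linarith
  · intro h
    obtain ⟨φ, ⟨h1, h2⟩, hx⟩ := exists_eq_pol x (κ / 2)
    have hpos : 0 < ‖x‖ := by
      rcases (norm_nonneg x).eq_or_lt with h0 | h0
      · rw [eq_comm, norm_eq_zero] at h0
        simp [h0] at h
      · exact h0
    nth_rewrite 2 [hx] at h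
    rw [inner_pol, mul_one, mul_comm, ← Real.cos_abs (φ - κ / 2)] at h
    have hcos := lt_of_mul_lt_mul_left h hpos.le
    have habs : |φ - κ / 2| < κ / 2 := by
      refine (Real.strictAntiOn_cos.lt_iff_gt ⟨by linarith, by linarith⟩
        ⟨abs_nonneg _, ?_⟩).1 hcos
      rw [abs_le]
      constructor <;> linarith
    rw [abs_lt] at habs
    rw [hx]
    exact pol_mem_Dset hpos (by linarith) (by linarith)

lemma continuous_pol (s : ℝ) : Continuous (pol s) := by
  unfold pol
  fun_prop

lemma exists_eq_pol_of_mem_frontier_Dset {κ : ℝ} (hκ : 0 < κ) (hκ' : κ < 2 * π) {y : E2}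
    (hy : y ∈ frontier (Dset κ)) : y = pol ‖y‖ 0 ∨ y = pol ‖y‖ κ := by
  have h : Dset κ = {x : E2 | Real.cos (κ / 2) * ‖x‖ < inner ℝ x (pol 1 (κ / 2))} :=
    Set.ext fun x => mem_Dset_iff hκ hκ'
  rw [h] at hy
  have hyeq : Real.cos (κ / 2) * ‖y‖ = inner ℝ y (pol 1 (κ / 2)) :=
    frontier_lt_subset_eq (by fun_prop) (by fun_prop) hy
  rcases (norm_nonneg y).eq_or_lt with h0 | h0
  · left
    rw [eq_comm, norm_eq_zero] at h0
    rw [h0, eq_pol_iff]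
    simp
  · obtain ⟨φ, ⟨h1, h2⟩, hy'⟩ := exists_eq_pol y (κ / 2)
    nth_rewrite 2 [hy'] at hyeq
    rw [inner_pol, mul_one, mul_comm, ← Real.cos_abs (φ - κ / 2)] at hyeq
    have hcos := mul_left_cancel₀ h0.ne' hyeq
    have habs : κ / 2 = |φ - κ / 2| := by
      refine Real.injOn_cos ⟨by linarith, by linarith⟩ ⟨abs_nonneg _, ?_⟩ hcos
      rw [abs_le]
      constructor <;> linarith
    rcases abs_cases (φ - κ / 2) with ⟨h3, -⟩ | ⟨h3, -⟩
    · right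
      rwa [show φ = κ by linarith] at hy'
    · left
      rwa [show φ = 0 by linarith] at hy'

lemma pol_mem_frontier_Dset {κ s θ : ℝ} (hκ : 0 < κ) (hκ' : κ < 2 * π) (hs : 0 < s)
    (hθ : θ = 0 ∨ θ = κ) : pol s θ ∈ frontier (Dset κ) := by
  rw [(isOpen_Dset hκ hκ').frontier_eq]
  constructor
  · have hmem : θ ∈ closure (Ioo 0 κ) := by
      rw [closure_Ioo hκ.ne]
      rcases hθ with rfl | rfl
      · exact ⟨le_rfl, hκ.le⟩
      · exact ⟨hκ.le, le_rfl⟩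
    exact map_mem_closure (continuous_pol s) hmem fun φ hφ => pol_mem_Dset hs hφ.1 hφ.2
  · rw [mem_Dset_iff hκ hκ', norm_pol hs.le, inner_pol, mul_one, mul_comm]
    have h : Real.cos (θ - κ / 2) = Real.cos (κ / 2) := by
      rcases hθ with rfl | rfl
      · rw [zero_sub, Real.cos_neg]
      · congr 1
        ring
    rw [h]
    exact lt_irrefl _

lemma dist_pol_sq (s φ t θ : ℝ) :
    dist (pol s φ) (pol t θ) ^ 2 = s ^ 2 + t ^ 2 - 2 * s * t * Real.cos (φ - θ) := by
  rw [dist_eq_norm, @norm_sub_sq_real, ← real_inner_self_eq_norm_sq,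
    ← real_inner_self_eq_norm_sq, inner_pol, inner_pol, inner_pol]
  simp only [sub_self, Real.cos_zero]
  ring

lemma dist_pol_le {s : ℝ} (hs : 0 ≤ s) (φ θ : ℝ) :
    dist (pol s φ) (pol s θ) ≤ s * |φ - θ| := by
  refine abs_le_of_sq_le_sq' ?_ (by positivity) |>.2
  rw [dist_pol_sq, mul_pow, sq_abs]
  nlinarith [Real.one_sub_sq_div_two_le_cos (x := φ - θ), sq_nonneg s]

lemma mul_abs_sin_half_le_dist_pol {s t : ℝ} (hs : 0 ≤ s) (ht : 0 ≤ t) (φ θ : ℝ) :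
    s * |Real.sin ((φ - θ) / 2)| ≤ dist (pol s φ) (pol t θ) := by
  refine abs_le_of_sq_le_sq' ?_ dist_nonneg |>.2
  have hsin : Real.sin ((φ - θ) / 2) ^ 2 = 1 / 2 - Real.cos (φ - θ) / 2 := by
    rw [Real.sin_sq_eq_half_sub]
    ring_nf
  rw [dist_pol_sq, mul_pow, sq_abs, hsin]
  have h1 := Real.cos_le_one (φ - θ)
  have h2 := Real.neg_one_le_cos (φ - θ)
  generalize Real.cos (φ - θ) = c at h1 h2
  rcases le_total 0 c with hc | hc
  · nlinarith [sq_nonneg (t - s * c), mul_nonneg (sq_nonneg s)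
      (mul_nonneg (sub_nonneg.2 h1) (by linarith : 0 ≤ 1 / 2 + c))]
  · nlinarith [mul_nonneg (mul_nonneg hs ht) (neg_nonneg.2 hc), sq_nonneg t,
      mul_nonneg (sq_nonneg s) (by linarith : 0 ≤ 1 + c)]

lemma mul_le_sin_half {κ u : ℝ} (hκ : 0 < κ) (hκ' : κ < 2 * π) (hu : 0 ≤ u) (huκ : u ≤ κ) :
    Real.sin (κ / 2) / κ * u ≤ Real.sin (u / 2) := by
  have h := strictConcaveOn_sin_Icc.concaveOn.2
    (⟨le_rfl, Real.pi_pos.le⟩ : (0 : ℝ) ∈ Icc 0 π)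
    (⟨by linarith, by linarith⟩ : κ / 2 ∈ Icc 0 π)
    (sub_nonneg.2 ((div_le_one hκ).2 huκ)) (div_nonneg hu hκ.le) (sub_add_cancel 1 (u / κ))
  simp only [smul_eq_mul, Real.sin_zero, mul_zero, zero_add] at h
  have h2 : u / κ * (κ / 2) = u / 2 := by field_simp
  rw [h2] at h
  calc _ = u / κ * Real.sin (κ / 2) := by ring
    _ ≤ _ := h

lemma sin_half_div_pos {κ : ℝ} (hκ : 0 < κ) (hκ' : κ < 2 * π) : 0 < Real.sin (κ / 2) / κ :=
  div_pos (Real.sin_pos_of_pos_of_lt_pi (by linarith) (by linarith)) hκ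

lemma rhoD_pol_le {κ s φ : ℝ} (hκ : 0 < κ) (hκ' : κ < 2 * π) (hs : 0 < s) (h0 : 0 < φ)
    (h1 : φ < κ) : rhoD κ (pol s φ) ≤ s * min φ (κ - φ) := by
  have key : ∀ θ : ℝ, θ = 0 ∨ θ = κ → rhoD κ (pol s φ) ≤ s * |φ - θ| := fun θ hθ =>
    (Metric.infDist_le_dist_of_mem (pol_mem_frontier_Dset hκ hκ' hs hθ)).trans
      (dist_pol_le hs.le φ θ)
  have k0 := key 0 (Or.inl rfl)
  have k1 := key κ (Or.inr rfl)
  rw [sub_zero, abs_of_pos h0] at k0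
  rw [abs_sub_comm, abs_of_pos (sub_pos.2 h1)] at k1
  rw [mul_min_of_nonneg _ _ hs.le]
  exact le_min k0 k1

lemma le_rhoD_pol {κ s φ : ℝ} (hκ : 0 < κ) (hκ' : κ < 2 * π) (hs : 0 < s) (h0 : 0 < φ)
    (h1 : φ < κ) : Real.sin (κ / 2) / κ * (s * min φ (κ - φ)) ≤ rhoD κ (pol s φ) := by
  have hc := sin_half_div_pos hκ hκ'
  refine (Metric.le_infDist ⟨_, pol_mem_frontier_Dset hκ hκ' hs (Or.inl rfl)⟩).2 fun y hy => ?_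
  have key : ∀ θ u : ℝ, |Real.sin ((φ - θ) / 2)| = |Real.sin (u / 2)| → 0 ≤ u → u ≤ κ →
      min φ (κ - φ) ≤ u → y = pol ‖y‖ θ →
      Real.sin (κ / 2) / κ * (s * min φ (κ - φ)) ≤ dist (pol s φ) y := by
    intro θ u hsin hu huκ hmin hyθ
    rw [hyθ]
    refine le_trans ?_ (mul_abs_sin_half_le_dist_pol hs.le (norm_nonneg y) φ θ)
    rw [hsin]
    calc Real.sin (κ / 2) / κ * (s * min φ (κ - φ))
        = s * (Real.sin (κ / 2) / κ * min φ (κ - φ)) := by ring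
      _ ≤ s * (Real.sin (κ / 2) / κ * u) := by gcongr
      _ ≤ s * |Real.sin (u / 2)| := by
        gcongr
        exact (mul_le_sin_half hκ hκ' hu huκ).trans (le_abs_self _)
  rcases exists_eq_pol_of_mem_frontier_Dset hκ hκ' hy with h | h
  · exact key 0 φ (by rw [sub_zero]) h0.le h1.le (min_le_left _ _) h
  · refine key κ (κ - φ) ?_ (by linarith) (by linarith) (min_le_right _ _) h
    rw [← abs_neg, ← Real.sin_neg]
    congr 2
    ring

lemma min_mul_rpow_le {a b c γ : ℝ} (hc : 0 < c) (ha : 0 < a) (h1 : c * a ≤ b) (h2 : b ≤ a) :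
    min 1 (c ^ γ) * a ^ γ ≤ b ^ γ := by
  have hb : 0 < b := (mul_pos hc ha).trans_le h1
  have haγ : 0 ≤ a ^ γ := Real.rpow_nonneg ha.le γ
  rcases le_total 0 γ with h | h
  · calc min 1 (c ^ γ) * a ^ γ ≤ c ^ γ * a ^ γ := by gcongr; exact min_le_right _ _
      _ = (c * a) ^ γ := (Real.mul_rpow hc.le ha.le).symm
      _ ≤ b ^ γ := Real.rpow_le_rpow (mul_pos hc ha).le h1 h
  · calc min 1 (c ^ γ) * a ^ γ ≤ 1 * a ^ γ := by gcongr; exact min_le_left _ _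
      _ ≤ b ^ γ := by rw [one_mul]; exact Real.rpow_le_rpow_of_nonpos hb h2 h

lemma rpow_le_max_mul {a b c γ : ℝ} (hc : 0 < c) (ha : 0 < a) (h1 : c * a ≤ b) (h2 : b ≤ a) :
    b ^ γ ≤ max 1 (c ^ γ) * a ^ γ := by
  have hb : 0 < b := (mul_pos hc ha).trans_le h1
  have haγ : 0 ≤ a ^ γ := Real.rpow_nonneg ha.le γ
  rcases le_total 0 γ with h | h
  · calc b ^ γ ≤ 1 * a ^ γ := by rw [one_mul]; exact Real.rpow_le_rpow hb.le h2 h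
      _ ≤ max 1 (c ^ γ) * a ^ γ := by gcongr; exact le_max_left _ _
  · calc b ^ γ ≤ (c * a) ^ γ := Real.rpow_le_rpow_of_nonpos (mul_pos hc ha) h1 h
      _ = c ^ γ * a ^ γ := Real.mul_rpow hc.le ha.le
      _ ≤ max 1 (c ^ γ) * a ^ γ := by gcongr; exact le_max_right _ _

lemma mul_rpow_mul_rpow {s m : ℝ} (hs : 0 < s) (hm : 0 ≤ m) (γ ν : ℝ) :
    s * s ^ (ν - γ) * (s * m) ^ γ = s ^ (ν + 1) * m ^ γ := by
  rw [Real.mul_rpow hs.le hm, ← mul_assoc]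
  congr 1
  nth_rewrite 1 [← Real.rpow_one s]
  rw [← Real.rpow_add hs, ← Real.rpow_add hs]
  congr 1
  ring

lemma mul_wgt_pol_bounds {κ s φ : ℝ} (γ ν : ℝ) (hκ : 0 < κ) (hκ' : κ < 2 * π) (hs : 0 < s)
    (h0 : 0 < φ) (h1 : φ < κ) :
    min 1 ((Real.sin (κ / 2) / κ) ^ γ) * (s ^ (ν + 1) * min φ (κ - φ) ^ γ)
        ≤ s * wgt κ γ ν (pol s φ) ∧
      s * wgt κ γ ν (pol s φ)
        ≤ max 1 ((Real.sin (κ / 2) / κ) ^ γ) * (s ^ (ν + 1) * min φ (κ - φ) ^ γ) := by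
  have hc := sin_half_div_pos hκ hκ'
  have hm : 0 < min φ (κ - φ) := lt_min h0 (sub_pos.2 h1)
  have hsν : 0 ≤ s * s ^ (ν - γ) := mul_nonneg hs.le (Real.rpow_nonneg hs.le _)
  have hl := le_rhoD_pol hκ hκ' hs h0 h1
  have hu := rhoD_pol_le hκ hκ' hs h0 h1
  have hw : s * wgt κ γ ν (pol s φ) = s * s ^ (ν - γ) * rhoD κ (pol s φ) ^ γ := by
    rw [wgt, norm_pol hs.le, mul_assoc]
  rw [hw, ← mul_rpow_mul_rpow hs hm.le, mul_left_comm, mul_left_comm (max _ _)]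
  exact ⟨mul_le_mul_of_nonneg_left (min_mul_rpow_le hc (mul_pos hs hm) hl hu) hsν,
    mul_le_mul_of_nonneg_left (rpow_le_max_mul hc (mul_pos hs hm) hl hu) hsν⟩

lemma injOn_polarCoord_symm :
    InjOn (fun p : ℝ × ℝ => polarCoord.symm p) (Ioi 0 ×ˢ Ioo 0 (2 * π)) := by
  rintro ⟨s, φ⟩ ⟨hs, hφ⟩ ⟨t, θ⟩ ⟨ht, hθ⟩ h
  simp only [polarCoord_symm_apply, Prod.mk.injEq] at h
  simp only [mem_Ioi, mem_Ioo] at hs ht hφ hθ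
  have hpol : pol s φ = pol t θ := eq_pol_iff.2 h
  have hst : s = t := by
    rw [← norm_pol hs.le φ, hpol, norm_pol ht.le]
  subst hst
  have hd := dist_pol_sq s φ s θ
  rw [hpol, dist_self] at hd
  have hcos : Real.cos (φ - θ) = 1 := by
    have h2 : s ^ 2 * (1 - Real.cos (φ - θ)) = 0 := by linarith
    rcases mul_eq_zero.1 h2 with h3 | h3
    · exact absurd h3 (by positivity)
    · linarith
  have := (Real.cos_eq_one_iff_of_lt_of_lt (by linarith [hφ.1, hθ.2]) (by linarith [hφ.2, hθ.1])).1
    hcos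
  rw [sub_eq_zero.1 this]

/-- Polar coordinates with angles in `(0, 2π)`. -/
lemma setLIntegral_pol_image {T : Set (ℝ × ℝ)} (hT : MeasurableSet T)
    (hsub : T ⊆ Ioi 0 ×ˢ Ioo 0 (2 * π)) (h : E2 → ℝ≥0∞) :
    ∫⁻ y in (fun p : ℝ × ℝ => pol p.1 p.2) '' T, h y
      = ∫⁻ p in T, ENNReal.ofReal p.1 * h (pol p.1 p.2) := by
  let e : E2 ≃ᵐ ℝ × ℝ :=
    (MeasurableEquiv.toLp 2 (Fin 2 → ℝ)).symm.trans MeasurableEquiv.finTwoArrow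
  have he : MeasurePreserving e := (volume_preserving_finTwoArrow ℝ).comp
    (EuclideanSpace.volume_preserving_symm_measurableEquiv_toLp (Fin 2))
  have hep : ∀ p : ℝ × ℝ, e (pol p.1 p.2) = polarCoord.symm p := fun p => rfl
  have hsymm : ∀ p : ℝ × ℝ, e.symm (polarCoord.symm p) = pol p.1 p.2 := fun p => by
    rw [← hep, MeasurableEquiv.symm_apply_apply]
  calc ∫⁻ y in (fun p : ℝ × ℝ => pol p.1 p.2) '' T, h y
      = ∫⁻ y in (fun p : ℝ × ℝ => pol p.1 p.2) '' T, (h ∘ e.symm) (e y) := by simp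
    _ = ∫⁻ z in (fun p : ℝ × ℝ => polarCoord.symm p) '' T, (h ∘ e.symm) z := by
      rw [he.setLIntegral_comp_emb e.measurableEmbedding, image_image]
      rfl
    _ = ∫⁻ p in T, ENNReal.ofReal |(fderivPolarCoordSymm p).det|
          * (h ∘ e.symm) (polarCoord.symm p) :=
      lintegral_image_eq_lintegral_abs_det_fderiv_mul volume hT
        (fun p _ => (hasFDerivAt_polarCoord_symm p).hasFDerivWithinAt)
        (injOn_polarCoord_symm.mono hsub) _
    _ = ∫⁻ p in T, ENNReal.ofReal p.1 * h (pol p.1 p.2) := by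
      refine setLIntegral_congr_fun hT fun p hp => ?_
      have hp1 : 0 < p.1 := (hsub hp).1
      simp only [Function.comp_apply, hsymm, det_fderivPolarCoordSymm, abs_of_pos hp1]

lemma setLIntegral_const_mul_prod {J Φ : Set ℝ} (c γ ν κ : ℝ) (hc : 0 ≤ c)
    (hJ : MeasurableSet J) (hΦ : MeasurableSet Φ) (hJ0 : J ⊆ Ioi 0) :
    ∫⁻ p in J ×ˢ Φ, ENNReal.ofReal (c * (p.1 ^ (ν + 1) * min p.2 (κ - p.2) ^ γ))
      = ENNReal.ofReal c * ((∫⁻ s in J, ENNReal.ofReal (s ^ (ν + 1)))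
          * ∫⁻ φ in Φ, ENNReal.ofReal (min φ (κ - φ) ^ γ)) := by
  have h : ∀ p ∈ J ×ˢ Φ, ENNReal.ofReal (c * (p.1 ^ (ν + 1) * min p.2 (κ - p.2) ^ γ))
      = ENNReal.ofReal c * (ENNReal.ofReal (p.1 ^ (ν + 1))
          * ENNReal.ofReal (min p.2 (κ - p.2) ^ γ)) := fun p hp => by
    rw [ENNReal.ofReal_mul hc, ENNReal.ofReal_mul (Real.rpow_nonneg (le_of_lt (hJ0 hp.1)) _)]
  rw [setLIntegral_congr_fun (hJ.prod hΦ) h, lintegral_const_mul _ (by fun_prop),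
    Measure.volume_eq_prod, ← Measure.prod_restrict,
    lintegral_prod_mul (f := fun s : ℝ => ENNReal.ofReal (s ^ (ν + 1)))
      (g := fun φ : ℝ => ENNReal.ofReal (min φ (κ - φ) ^ γ)) (by fun_prop) (by fun_prop)]

lemma wMeas_pol_image_bounds {κ : ℝ} (γ ν : ℝ) (hκ : 0 < κ) (hκ' : κ < 2 * π) {J Φ : Set ℝ}
    (hJ : MeasurableSet J) (hΦ : MeasurableSet Φ) (hJ0 : J ⊆ Ioi 0) (hΦ0 : Φ ⊆ Ioo 0 κ) :
    ENNReal.ofReal (min 1 ((Real.sin (κ / 2) / κ) ^ γ)) *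
        ((∫⁻ s in J, ENNReal.ofReal (s ^ (ν + 1)))
          * ∫⁻ φ in Φ, ENNReal.ofReal (min φ (κ - φ) ^ γ))
        ≤ wMeas κ γ ν ((fun p : ℝ × ℝ => pol p.1 p.2) '' J ×ˢ Φ) ∧
      wMeas κ γ ν ((fun p : ℝ × ℝ => pol p.1 p.2) '' J ×ˢ Φ)
        ≤ ENNReal.ofReal (max 1 ((Real.sin (κ / 2) / κ) ^ γ)) *
          ((∫⁻ s in J, ENNReal.ofReal (s ^ (ν + 1)))
            * ∫⁻ φ in Φ, ENNReal.ofReal (min φ (κ - φ) ^ γ)) := by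
  have hc := Real.rpow_nonneg (sin_half_div_pos hκ hκ').le γ
  have hT : MeasurableSet (J ×ˢ Φ) := hJ.prod hΦ
  have hsub : J ×ˢ Φ ⊆ Ioi 0 ×ˢ Ioo 0 (2 * π) :=
    prod_mono hJ0 (hΦ0.trans (Ioo_subset_Ioo_right hκ'.le))
  rw [← setLIntegral_const_mul_prod _ γ ν κ (le_min zero_le_one hc) hJ hΦ hJ0,
    ← setLIntegral_const_mul_prod _ γ ν κ (le_max_of_le_left zero_le_one) hJ hΦ hJ0, wMeas,
    setLIntegral_pol_image hT hsub]
  constructor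
  · refine setLIntegral_mono' hT fun p hp => ?_
    have hp1 : 0 < p.1 := hJ0 hp.1
    rw [← ENNReal.ofReal_mul hp1.le]
    exact ENNReal.ofReal_le_ofReal
      (mul_wgt_pol_bounds γ ν hκ hκ' hp1 (hΦ0 hp.2).1 (hΦ0 hp.2).2).1
  · refine setLIntegral_mono' hT fun p hp => ?_
    have hp1 : 0 < p.1 := hJ0 hp.1
    rw [← ENNReal.ofReal_mul hp1.le]
    exact ENNReal.ofReal_le_ofReal
      (mul_wgt_pol_bounds γ ν hκ hκ' hp1 (hΦ0 hp.2).1 (hΦ0 hp.2).2).2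

lemma arccos_cos_le_abs (δ : ℝ) : Real.arccos (Real.cos δ) ≤ |δ| := by
  rcases le_total |δ| π with h | h
  · rw [← Real.cos_abs, Real.arccos_cos (abs_nonneg _) h]
  · exact (Real.arccos_le_pi _).trans h

lemma abs_lt_of_arccos_cos_lt {δ κ t : ℝ} (hδ : |δ| < κ) (hκ' : κ < 2 * π) (ht : t ≤ 2 * π - κ)
    (h : Real.arccos (Real.cos δ) < t) : |δ| < t := by
  rcases le_total |δ| π with hπ | hπ
  · rwa [← Real.cos_abs, Real.arccos_cos (abs_nonneg _) hπ] at h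
  · rw [← Real.cos_abs, ← Real.cos_two_pi_sub,
      Real.arccos_cos (by linarith) (by linarith)] at h
    linarith

lemma Sset_pol {κ a A r : ℝ} (ha : 0 < a) :
    Sset κ (pol a A) r = (fun p : ℝ × ℝ => pol p.1 p.2) '' (Ioo (max (a - r) 0) (a + r) ×ˢ
      {φ | φ ∈ Ioo 0 κ ∧ Real.arccos (Real.cos (A - φ)) < r / a}) := by
  have hx : pol a A ≠ 0 := by
    rw [← norm_ne_zero_iff, norm_pol ha.le]
    exact ha.ne'
  have hdS : ∀ s φ : ℝ, 0 < s → dS1 (‖pol a A‖⁻¹ • pol a A) (‖pol s φ‖⁻¹ • pol s φ)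
      = Real.arccos (Real.cos (A - φ)) := fun s φ hs => by
    rw [dS1, norm_pol ha.le, norm_pol hs.le, smul_pol, smul_pol, inv_mul_cancel₀ ha.ne',
      inv_mul_cancel₀ hs.ne', inner_pol, one_mul, one_mul]
  ext y
  constructor
  · rintro ⟨hy, hr, hd⟩
    obtain ⟨s, φ, hs, h0, h1, rfl⟩ := mem_Dset_iff_exists.1 hy
    have hd' := hd hx
    rw [hdS s φ hs, norm_pol ha.le] at hd'
    rw [norm_pol ha.le, norm_pol hs.le, abs_lt] at hr
    exact ⟨(s, φ), ⟨⟨max_lt (by linarith) hs, by linarith⟩, ⟨h0, h1⟩, hd'⟩, rfl⟩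
  · rintro ⟨⟨s, φ⟩, ⟨⟨hs1, hs2⟩, ⟨h0, h1⟩, hd⟩, rfl⟩
    simp only [max_lt_iff] at hs1 hs2 h0 h1 hd ⊢
    refine ⟨pol_mem_Dset hs1.2 h0 h1, ?_, fun _ => ?_⟩
    · rw [norm_pol ha.le, norm_pol hs1.2.le, abs_lt]
      constructor <;> linarith
    · rw [hdS s φ hs1.2, norm_pol ha.le]
      exact hd

lemma ofReal_intervalIntegral_eq_setLIntegral_Ioo {f : ℝ → ℝ} {a b : ℝ} (hab : a ≤ b)
    (hf : IntervalIntegrable f volume a b) (hf0 : ∀ x ∈ Ioc a b, 0 ≤ f x) :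
    ENNReal.ofReal (∫ x in a..b, f x) = ∫⁻ x in Ioo a b, ENNReal.ofReal (f x) := by
  rw [intervalIntegral.integral_of_le hab, ofReal_integral_eq_lintegral_ofReal hf.1
    ((ae_restrict_iff' measurableSet_Ioc).2 (Filter.Eventually.of_forall hf0)),
    setLIntegral_congr Ioo_ae_eq_Ioc]

lemma min_rpow_nonneg {κ φ : ℝ} (γ : ℝ) (h0 : 0 ≤ φ) (h1 : φ ≤ κ) : 0 ≤ min φ (κ - φ) ^ γ :=
  Real.rpow_nonneg (le_min h0 (sub_nonneg.2 h1)) γ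

lemma intervalIntegrable_min_rpow {κ γ : ℝ} (hκ : 0 < κ) (hγ : -1 < γ) :
    IntervalIntegrable (fun φ => min φ (κ - φ) ^ γ) volume 0 κ := by
  have h1 : IntervalIntegrable (fun φ : ℝ => φ ^ γ) volume 0 κ :=
    intervalIntegral.intervalIntegrable_rpow' hγ
  have h2 : IntervalIntegrable (fun φ : ℝ => (κ - φ) ^ γ) volume 0 κ := by
    simpa using (h1.comp_sub_left κ).symm
  refine (h1.add h2).mono_fun (Measurable.aestronglyMeasurable (by fun_prop)) ?_
  rw [uIoc_of_le hκ.le]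
  refine (ae_restrict_iff' measurableSet_Ioc).2 (Filter.Eventually.of_forall fun φ hφ => ?_)
  have e1 := Real.rpow_nonneg hφ.1.le γ
  have e2 := Real.rpow_nonneg (sub_nonneg.2 hφ.2) γ
  simp only [Real.norm_eq_abs]
  rw [abs_of_nonneg (min_rpow_nonneg γ hφ.1.le hφ.2), abs_of_nonneg (add_nonneg e1 e2)]
  rcases min_choice φ (κ - φ) with h | h <;> rw [h] <;> linarith

/-- Angular intervals of radius at least `t₀` carry a mass bounded below independently of the
centre. -/
lemma exists_le_setLIntegral_min_rpow {κ t₀ : ℝ} (γ : ℝ) (hκ : 0 < κ) (ht₀ : 0 < t₀) :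
    ∃ δ : ℝ, 0 < δ ∧ ∀ A t : ℝ, 0 < A → A < κ → t₀ ≤ t → ENNReal.ofReal δ ≤
      ∫⁻ φ in Ioo (max (A - t) 0) (min (A + t) κ), ENNReal.ofReal (min φ (κ - φ) ^ γ) := by
  set l := min t₀ (κ / 4) with hl
  have hl0 : 0 < l := lt_min ht₀ (by linarith)
  have hl1 : l ≤ t₀ := min_le_left _ _
  have hl2 : l ≤ κ / 4 := min_le_right _ _
  set β := min ((l / 2) ^ γ) (κ ^ γ) with hβ
  have hβ0 : 0 < β := lt_min (by positivity) (by positivity)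
  have hlow : ∀ u : ℝ, l / 2 ≤ u → u ≤ κ → β ≤ u ^ γ := fun u h1 h2 => by
    rcases le_total 0 γ with h | h
    · exact (min_le_left _ _).trans (Real.rpow_le_rpow (by positivity) h1 h)
    · exact (min_le_right _ _).trans
        (Real.rpow_le_rpow_of_nonpos (by linarith) h2 h)
  refine ⟨β * (l / 2), by positivity, fun A t hA0 hA1 ht => ?_⟩
  have key : ∀ a : ℝ, max (A - t) 0 ≤ a → a + l / 2 ≤ min (A + t) κ → l / 2 ≤ a →
      a + l ≤ κ → ENNReal.ofReal (β * (l / 2)) ≤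
      ∫⁻ φ in Ioo (max (A - t) 0) (min (A + t) κ), ENNReal.ofReal (min φ (κ - φ) ^ γ) := by
    intro a h1 h2 h3 h4
    calc ENNReal.ofReal (β * (l / 2))
        = ∫⁻ _ in Ioo a (a + l / 2), ENNReal.ofReal β := by
          rw [setLIntegral_const, Real.volume_Ioo, add_sub_cancel_left,
            ENNReal.ofReal_mul hβ0.le]
      _ ≤ ∫⁻ φ in Ioo a (a + l / 2), ENNReal.ofReal (min φ (κ - φ) ^ γ) := by
          refine setLIntegral_mono' measurableSet_Ioo fun φ hφ => ENNReal.ofReal_le_ofReal ?_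
          refine hlow _ (le_min ?_ ?_) ((min_le_left _ _).trans ?_) <;>
            linarith [hφ.1, hφ.2]
      _ ≤ _ := lintegral_mono_set (Ioo_subset_Ioo h1 h2)
  rcases le_total A (κ / 2) with h | h
  · exact key (A + l / 2) (max_le (by linarith) (by linarith))
      (le_min (by linarith) (by linarith)) (by linarith) (by linarith)
  · exact key (A - l) (max_le (by linarith) (by linarith))
      (le_min (by linarith) (by linarith)) (by linarith) (by linarith)

lemma measurableSet_angles (κ A t : ℝ) :
    MeasurableSet {φ | φ ∈ Ioo 0 κ ∧ Real.arccos (Real.cos (A - φ)) < t} :=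
  measurableSet_Ioo.inter (measurableSet_lt
    (Real.continuous_arccos.comp (by fun_prop)).measurable measurable_const)

lemma Ioo_subset_angles (κ A t : ℝ) : Ioo (max (A - t) 0) (min (A + t) κ) ⊆
    {φ | φ ∈ Ioo 0 κ ∧ Real.arccos (Real.cos (A - φ)) < t} := by
  rintro φ ⟨h1, h2⟩
  rw [max_lt_iff] at h1
  rw [lt_min_iff] at h2
  refine ⟨⟨h1.2, h2.2⟩, (arccos_cos_le_abs _).trans_lt ?_⟩
  rw [abs_lt]
  constructor <;> linarith

/-- The angles close to `A` in the geodesic distance carry at most a multiple of the mass of the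
angles close to `A` in the Euclidean distance of `(0, κ)`. -/
lemma exists_setLIntegral_angles_le {κ γ : ℝ} (hκ : 0 < κ) (hκ' : κ < 2 * π) (hγ : -1 < γ) :
    ∃ K : ℝ, 1 ≤ K ∧ ∀ A t : ℝ, 0 < A → A < κ →
      ∫⁻ φ in {φ | φ ∈ Ioo 0 κ ∧ Real.arccos (Real.cos (A - φ)) < t},
          ENNReal.ofReal (min φ (κ - φ) ^ γ)
        ≤ ENNReal.ofReal K * ∫⁻ φ in Ioo (max (A - t) 0) (min (A + t) κ),
            ENNReal.ofReal (min φ (κ - φ) ^ γ) := by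
  obtain ⟨δ, hδ, hlow⟩ := exists_le_setLIntegral_min_rpow γ hκ (sub_pos.2 hκ')
  set M : ℝ := ∫ φ in (0 : ℝ)..κ, min φ (κ - φ) ^ γ with hM
  have hMeq : ENNReal.ofReal M = ∫⁻ φ in Ioo 0 κ, ENNReal.ofReal (min φ (κ - φ) ^ γ) :=
    ofReal_intervalIntegral_eq_setLIntegral_Ioo hκ.le (intervalIntegrable_min_rpow hκ hγ)
      fun φ hφ => min_rpow_nonneg γ hφ.1.le hφ.2
  refine ⟨max 1 (M / δ), le_max_left _ _, fun A t hA0 hA1 => ?_⟩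
  rcases le_total t (2 * π - κ) with ht | ht
  · have hsub : {φ | φ ∈ Ioo 0 κ ∧ Real.arccos (Real.cos (A - φ)) < t}
        ⊆ Ioo (max (A - t) 0) (min (A + t) κ) := by
      rintro φ ⟨⟨h0, h1⟩, hφ⟩
      have habs := abs_lt_of_arccos_cos_lt
        (abs_lt.2 ⟨by linarith, by linarith⟩ : |A - φ| < κ) hκ' ht hφ
      rw [abs_lt] at habs
      exact ⟨max_lt (by linarith) h0, lt_min (by linarith) h1⟩
    calc _ ≤ _ := lintegral_mono_set hsub
      _ = ENNReal.ofReal 1 * _ := by rw [ENNReal.ofReal_one, one_mul]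
      _ ≤ _ := by gcongr; exact le_max_left _ _
  · calc _ ≤ ∫⁻ φ in Ioo 0 κ, ENNReal.ofReal (min φ (κ - φ) ^ γ) :=
          lintegral_mono_set fun φ hφ => hφ.1
      _ = ENNReal.ofReal (M / δ * δ) := by rw [← hMeq, div_mul_cancel₀ _ hδ.ne']
      _ ≤ ENNReal.ofReal (max 1 (M / δ) * δ) := by gcongr; exact le_max_right _ _
      _ = ENNReal.ofReal (max 1 (M / δ)) * ENNReal.ofReal δ :=
          ENNReal.ofReal_mul (le_max_of_le_left zero_le_one)
      _ ≤ _ := by gcongr; exact hlow A t hA0 hA1 ht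

lemma ofReal_radial_integral {a r ν : ℝ} (ha : 0 < a) (hr : 0 < r) (hν : -2 < ν) :
    ENNReal.ofReal (∫ s in (max (a - r) 0)..(a + r), s ^ (ν + 1))
      = ∫⁻ s in Ioo (max (a - r) 0) (a + r), ENNReal.ofReal (s ^ (ν + 1)) :=
  ofReal_intervalIntegral_eq_setLIntegral_Ioo (max_le (by linarith) (by linarith))
    (intervalIntegral.intervalIntegrable_rpow' (by linarith))
    fun s hs => Real.rpow_nonneg ((le_max_right _ _).trans hs.1.le) _

lemma ofReal_angular_integral {κ γ A t : ℝ} (hγ : -1 < γ) (hA0 : 0 < A)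
    (hA1 : A < κ) (ht : 0 < t) :
    ENNReal.ofReal (∫ φ in (max (A - t) 0)..(min (A + t) κ), min φ (κ - φ) ^ γ)
      = ∫⁻ φ in Ioo (max (A - t) 0) (min (A + t) κ), ENNReal.ofReal (min φ (κ - φ) ^ γ) := by
  have hκ := hA0.trans hA1
  have h1 : max (A - t) 0 ≤ A := max_le (by linarith) hA0.le
  have h2 : A ≤ min (A + t) κ := le_min (by linarith) hA1.le
  refine ofReal_intervalIntegral_eq_setLIntegral_Ioo (h1.trans h2)
    ((intervalIntegrable_min_rpow hκ hγ).mono_set ?_) fun φ hφ =>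
      min_rpow_nonneg γ ((le_max_right _ _).trans hφ.1.le) (hφ.2.trans (min_le_right _ _))
  rw [uIcc_of_le (h1.trans h2), uIcc_of_le hκ.le]
  exact Icc_subset_Icc (le_max_right _ _) (min_le_right _ _)

theorem stmt19 (κ : ℝ) (hκ : 0 < κ) (hκ' : κ < 2 * π)
    (γ ν : ℝ) (hγ : -1 < γ) (hν : -2 < ν) :
    ∃ c C : ℝ, 0 < c ∧ c ≤ C ∧
      ∀ x ∈ Dset κ, ∀ r : ℝ, 0 < r → ∀ A : ℝ,
        0 < A → A < κ → x 0 = ‖x‖ * Real.cos A → x 1 = ‖x‖ * Real.sin A →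
        ENNReal.ofReal (c *
            ((∫ s in (max (‖x‖ - r) 0)..(‖x‖ + r), s ^ (ν + 1)) *
              (∫ φ in (max (A - r / ‖x‖) 0)..(min (A + r / ‖x‖) κ), min φ (κ - φ) ^ γ)))
          ≤ wMeas κ γ ν (Sset κ x r) ∧
        wMeas κ γ ν (Sset κ x r)
          ≤ ENNReal.ofReal (C *
              ((∫ s in (max (‖x‖ - r) 0)..(‖x‖ + r), s ^ (ν + 1)) *
                (∫ φ in (max (A - r / ‖x‖) 0)..(min (A + r / ‖x‖) κ), min φ (κ - φ) ^ γ))) := by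
  have hc := sin_half_div_pos hκ hκ'
  obtain ⟨K, hK, hangles⟩ := exists_setLIntegral_angles_le hκ hκ' hγ
  have hmax : (1 : ℝ) ≤ max 1 ((Real.sin (κ / 2) / κ) ^ γ) := le_max_left _ _
  refine ⟨min 1 ((Real.sin (κ / 2) / κ) ^ γ), max 1 ((Real.sin (κ / 2) / κ) ^ γ) * K,
    lt_min one_pos (Real.rpow_pos_of_pos hc γ),
    (min_le_left _ _).trans (one_le_mul_of_one_le_of_one_le hmax hK), ?_⟩
  intro x hx r hr A hA0 hA1 hx0 hx1
  obtain ⟨a, ha, rfl⟩ : ∃ a, 0 < a ∧ x = pol a A := by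
    obtain ⟨s, φ, hs, -, -, hxs⟩ := mem_Dset_iff_exists.1 hx
    exact ⟨‖x‖, by rwa [hxs, norm_pol hs.le], eq_pol_iff.2 ⟨hx0, hx1⟩⟩
  have ht : 0 < r / a := div_pos hr ha
  have hJ0 : Ioo (max (a - r) 0) (a + r) ⊆ Ioi 0 := fun s hs => (max_lt_iff.1 hs.1).2
  have hw := wMeas_pol_image_bounds γ ν hκ hκ' (measurableSet_Ioo (a := max (a - r) 0) (b := a + r))
    (measurableSet_angles κ A (r / a)) hJ0 fun φ hφ => hφ.1
  rw [← Sset_pol ha] at hw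
  have hP : 0 ≤ ∫ s in (max (a - r) 0)..(a + r), s ^ (ν + 1) :=
    intervalIntegral.integral_nonneg (max_le (by linarith) (by linarith))
      fun s hs => Real.rpow_nonneg ((le_max_right _ _).trans hs.1) _
  rw [norm_pol ha.le, ENNReal.ofReal_mul (le_min zero_le_one (Real.rpow_nonneg hc.le γ)),
    ENNReal.ofReal_mul (by positivity : 0 ≤ max 1 ((Real.sin (κ / 2) / κ) ^ γ) * K),
    ENNReal.ofReal_mul (zero_le_one.trans hmax), ENNReal.ofReal_mul hP,
    ofReal_radial_integral ha hr hν, ofReal_angular_integral hγ hA0 hA1 ht]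
  constructor
  · refine le_trans ?_ hw.1
    gcongr
    exact Ioo_subset_angles κ A (r / a)
  · refine hw.2.trans ?_
    rw [mul_assoc (ENNReal.ofReal (max _ _)), mul_left_comm (ENNReal.ofReal K)]
    gcongr
    exact hangles A (r / a) hA0 hA1
end
end
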